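/- arXiv:math/0602536 — 9 statements merged into one kernel-verified Lean document; each statement's English description precedes it below -/
import Mathlib

section
/- Let a ∈ ℝ be a constant. The functions t(x₁,x₂) = 0 and z(x₁,x₂) = (1−x₁−a)/((x₁+x₂−1)(x₂−a)) satisfy, at every point (x₁,x₂) with x₁+x₂ ≠ 1 and x₂ ≠ a, the system of partial differential equations: t₁ = t² − t + t/(x₁+x₂−1), t₂ = tz, z₁ = tz − 1/(x₁+x₂−1)², z₂ = z² − 2z/(x₁+x₂−1). -/
/-- The partial derivative with respect to the first coordinate. -/
noncomputable def pd1 (g : ℝ × ℝ → ℝ) (p : ℝ × ℝ) : ℝ :=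
  deriv (fun x => g (x, p.2)) p.1

/-- The partial derivative with respect to the second coordinate. -/
noncomputable def pd2 (g : ℝ × ℝ → ℝ) (p : ℝ × ℝ) : ℝ :=
  deriv (fun y => g (p.1, y)) p.2

/-- Solution 1: `t ≡ 0` and `z = (1−x₁−a)/((x₁+x₂−1)(x₂−a))` solve the reduced
linearization system `t₁ = t² − t + t/(x₁+x₂−1)`, `t₂ = tz`,
`z₁ = tz − 1/(x₁+x₂−1)²`, `z₂ = z² − 2z/(x₁+x₂−1)` wherever `x₁+x₂ ≠ 1` and
`x₂ ≠ a`. -/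
theorem solution1_solves_reduced_system (a : ℝ) (t z : ℝ × ℝ → ℝ)
    (ht : t = fun _ => 0)
    (hz : z = fun p => (1 - p.1 - a) / ((p.1 + p.2 - 1) * (p.2 - a))) :
    ∀ p : ℝ × ℝ, p.1 + p.2 ≠ 1 → p.2 ≠ a →
      pd1 t p = (t p) ^ 2 - t p + t p / (p.1 + p.2 - 1) ∧
      pd2 t p = t p * z p ∧
      pd1 z p = t p * z p - 1 / (p.1 + p.2 - 1) ^ 2 ∧
      pd2 z p = (z p) ^ 2 - 2 * z p / (p.1 + p.2 - 1) := by
  subst ht hz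
  rintro ⟨x, y⟩ hxy hya
  have hs : x + y - 1 ≠ 0 := sub_ne_zero.mpr hxy
  have hd : y - a ≠ 0 := sub_ne_zero.mpr hya
  refine ⟨by simp [pd1], by simp [pd2], ?_, ?_⟩
  · have h : HasDerivAt (fun u => (1 - u - a) / ((u + y - 1) * (y - a))) _ x :=
      (((hasDerivAt_id' x).const_sub 1).sub_const a).div
        ((((hasDerivAt_id' x).add_const y).sub_const 1).mul_const (y - a)) (mul_ne_zero hs hd)
    simp only [pd1, h.deriv]
    field_simp
    ring
  · have h : HasDerivAt (fun v => (1 - x - a) / ((x + v - 1) * (v - a))) _ y :=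
      (hasDerivAt_const y (1 - x - a)).div
        ((((hasDerivAt_id' y).const_add x).sub_const 1).mul ((hasDerivAt_id' y).sub_const a))
        (mul_ne_zero hs hd)
    simp only [pd2, h.deriv]
    field_simp
    ring
end

section
/- Let a, b ∈ ℝ be constants, and set D(x₁,x₂) := (x₁+x₂)e^{−x₁} + a x₂ + b. The functions t(x₁,x₂) = (x₁+x₂−1)e^{−x₁}/D(x₁,x₂) and z(x₁,x₂) = (e^{−x₁} + a − x₁a + b)/(D(x₁,x₂)(x₁+x₂−1)) satisfy, at every point (x₁,x₂) with x₁+x₂ ≠ 1 and D(x₁,x₂) ≠ 0, the system of partial differential equations: t₁ = t² − t + t/(x₁+x₂−1), t₂ = tz, z₁ = tz − 1/(x₁+x₂−1)², z₂ = z² − 2z/(x₁+x₂−1). -/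
/-- Solution 2: with `D = (x₁+x₂)e^{−x₁} + a x₂ + b`, the functions
`t = (x₁+x₂−1)e^{−x₁}/D` and `z = (e^{−x₁} + a − x₁a + b)/(D(x₁+x₂−1))` solve
the reduced linearization system `t₁ = t² − t + t/(x₁+x₂−1)`, `t₂ = tz`,
`z₁ = tz − 1/(x₁+x₂−1)²`, `z₂ = z² − 2z/(x₁+x₂−1)` wherever `x₁+x₂ ≠ 1` and
`D ≠ 0`. -/
theorem solution2_solves_reduced_system (a b : ℝ) (D t z : ℝ × ℝ → ℝ)
    (hD : D = fun p => (p.1 + p.2) * Real.exp (-p.1) + a * p.2 + b)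
    (ht : t = fun p => (p.1 + p.2 - 1) * Real.exp (-p.1) / D p)
    (hz : z = fun p =>
      (Real.exp (-p.1) + a - p.1 * a + b) / (D p * (p.1 + p.2 - 1))) :
    ∀ p : ℝ × ℝ, p.1 + p.2 ≠ 1 → D p ≠ 0 →
      pd1 t p = (t p) ^ 2 - t p + t p / (p.1 + p.2 - 1) ∧
      pd2 t p = t p * z p ∧
      pd1 z p = t p * z p - 1 / (p.1 + p.2 - 1) ^ 2 ∧
      pd2 z p = (z p) ^ 2 - 2 * z p / (p.1 + p.2 - 1) := by
  subst hD ht hz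
  rintro ⟨x, y⟩ hs hD
  simp only [pd1, pd2] at hs hD ⊢
  have hs' : x + y - 1 ≠ 0 := sub_ne_zero.mpr hs
  have hE : HasDerivAt (fun u : ℝ => Real.exp (-u)) (-Real.exp (-x)) x := by
    simpa using (hasDerivAt_neg x).exp
  have hS1 : HasDerivAt (fun u : ℝ => u + y) 1 x := (hasDerivAt_id x).add_const y
  have hS2 : HasDerivAt (fun v : ℝ => x + v) 1 y := (hasDerivAt_id y).const_add x
  have hD1 := ((hS1.mul hE).add_const (a * y)).add_const b
  have hD2 := ((hS2.mul_const (Real.exp (-x))).add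
    ((hasDerivAt_id y).const_mul a)).add_const b
  have hN1 := ((hE.add_const a).sub ((hasDerivAt_id x).mul_const a)).add_const b
  have ht1 := ((hS1.sub_const 1).mul hE).div hD1 hD
  have ht2 := ((hS2.sub_const 1).mul_const (Real.exp (-x))).div hD2 hD
  have hz1 := hN1.div (hD1.mul (hS1.sub_const 1)) (mul_ne_zero hD hs')
  have hz2 := (hasDerivAt_const y (Real.exp (-x) + a - x * a + b)).div
    (hD2.mul (hS2.sub_const 1)) (mul_ne_zero hD hs')
  refine ⟨ht1.deriv.trans ?_, ht2.deriv.trans ?_, hz1.deriv.trans ?_, hz2.deriv.trans ?_⟩ <;>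
  · simp only [Pi.mul_apply, Pi.add_apply, Pi.sub_apply, id]
    generalize Real.exp (-x) = e at hD ⊢
    generalize hd : (x + y) * e + a * y + b = d at hD ⊢
    obtain rfl : b = d - (x + y) * e - a * y := by linarith
    field_simp
    ring
end

section
/- Let a ∈ ℝ be a constant and consider the functions L₁₁¹(x₁,x₂) = −1, L₂₂²(x₁,x₂) = −(x₂ − 2 + 2x₁ + a)/((x₁+x₂−1)(x₂−a)), L₁₂¹(x₁,x₂) = (1−x₁−a)/((x₁+x₂−1)(x₂−a)), L₁₂²(x₁,x₂) = 0. Then at every point with x₁+x₂ ≠ 1 and x₂ ≠ a, with r = 1/(x₁+x₂−1)², Γ₁ = 1/(x₁+x₂−1), Γ₂ = 1/(1−x₁−x₂), the four partial differential equations of linearization hold: (i) r + ∂₁L₁₂¹ − ∂₂L₁₁¹ + L₁₂²L₁₂¹ = 0; (ii) ∂₁L₁₂² − Γ₁L₁₂² + (L₁₂²)² − L₁₁¹L₁₂² = 0; (iii) −∂₂L₁₂¹ + Γ₂L₁₂¹ + L₂₂²L₁₂¹ − (L₁₂¹)² = 0; (iv) r + ∂₁L₂₂² − ∂₂L₁₂²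 − L₁₂¹L₁₂² = 0. -/
/-- The components of the affine deformation tensor of Solution 1 satisfy the
four PDEs of linearization, with `r = 1/(x₁+x₂−1)²`, `Γ₁ = 1/(x₁+x₂−1)`,
`Γ₂ = 1/(1−x₁−x₂)`. Here `L^k_{ij}` is written `Lijk`. -/
theorem solution1_satisfies_linearization_PDE (a : ℝ)
    (L111 L222 L121 L122 : ℝ × ℝ → ℝ)
    (h111 : L111 = fun _ => -1)
    (h222 : L222 = fun p =>
      -(p.2 - 2 + 2 * p.1 + a) / ((p.1 + p.2 - 1) * (p.2 - a)))
    (h121 : L121 = fun p => (1 - p.1 - a) / ((p.1 + p.2 - 1) * (p.2 - a)))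
    (h122 : L122 = fun _ => 0) :
    ∀ p : ℝ × ℝ, p.1 + p.2 ≠ 1 → p.2 ≠ a →
      1 / (p.1 + p.2 - 1) ^ 2 + pd1 L121 p - pd2 L111 p
        + L122 p * L121 p = 0 ∧
      pd1 L122 p - (1 / (p.1 + p.2 - 1)) * L122 p + (L122 p) ^ 2
        - L111 p * L122 p = 0 ∧
      -pd2 L121 p + (1 / (1 - p.1 - p.2)) * L121 p + L222 p * L121 p
        - (L121 p) ^ 2 = 0 ∧
      1 / (p.1 + p.2 - 1) ^ 2 + pd1 L222 p - pd2 L122 p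
        - L121 p * L122 p = 0 := by
  subst h111 h222 h121 h122
  rintro ⟨x, y⟩ hs ht
  dsimp only at hs ht
  have hs' : x + y - 1 ≠ 0 := sub_ne_zero.mpr hs
  have ht' : y - a ≠ 0 := sub_ne_zero.mpr ht
  have hne : (x + y - 1) * (y - a) ≠ 0 := mul_ne_zero hs' ht'
  have hden₁ : HasDerivAt (fun u => (u + y - 1) * (y - a)) (1 * (y - a)) x :=
    (((hasDerivAt_id x).add_const y).sub_const 1).mul_const (y - a)
  have hden₂ : HasDerivAt (fun v => (x + v - 1) * (v - a))
      (1 * (y - a) + (x + y - 1) * 1) y :=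
    (((hasDerivAt_id y).const_add x).sub_const 1).mul ((hasDerivAt_id y).sub_const a)
  have h121₁ := ((((hasDerivAt_id' x).const_sub 1).sub_const a).fun_div hden₁ hne).deriv
  have h121₂ := ((hasDerivAt_const y (1 - x - a)).fun_div hden₂ hne).deriv
  have h222₁ := ((((((hasDerivAt_id' x).const_mul 2).const_add (y - 2)).add_const a).fun_neg).fun_div
    hden₁ hne).deriv
  simp only [pd1, pd2, deriv_const, h121₁, h121₂, h222₁]
  have hΓ : 1 / (1 - x - y) = -(1 / (x + y - 1)) := by
    rw [← one_div_neg_eq_neg_one_div]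
    congr 1
    ring
  rw [hΓ]
  refine ⟨?_, by ring, ?_, ?_⟩ <;> field_simp <;> ring
end

section
/- Let a, b ∈ ℝ be constants, c(x₁,x₂) = 1 − x₁ − x₂, D(x₁,x₂) := (x₁+x₂)e^{−x₁} + a x₂ + b, and consider the tensor components L₁₁¹ = ((x₁+x₂−2)e^{−x₁} − ax₂ − b)/D, L₂₂² = ((2−x₁−x₂)e^{−x₁} − a(2x₁+x₂−2) + b)/((x₁+x₂−1)D), L₁₂¹ = (e^{−x₁} + a − x₁a + b)/(D(x₁+x₂−1)), L₁₂² = (x₁+x₂−1)e^{−x₁}/D, L₁₁² = 0, L₂₂¹ = 0. Then at every point with x₁+x₂ ≠ 1 and D ≠ 0 the algebraic prelinearization conditions hold: L₁₁² = 0, L₂₂¹ = 0, and L₁₂² = (1/2)(L₁₁¹ + cL₂₂² − 2cL₁₂¹); moreover the base of this prelinearization satisfies 2cL₁₂¹ − cL₂₂² = −1 identically. -/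
/-- The tensor of Solution 2 satisfies the algebraic prelinearization
conditions `L₁₁² = 0`, `L₂₂¹ = 0`, `L₁₂² = (1/2)(L₁₁¹ + cL₂₂² − 2cL₁₂¹)`, and
its base satisfies `2cL₁₂¹ − cL₂₂² = −1`. Here `L^k_{ij}` is written `Lijk`. -/
theorem solution2_is_prelinearization_with_base_minus_one
    (a b x₁ x₂ : ℝ) (c D L111 L222 L121 L122 L112 L221 : ℝ)
    (hc : c = 1 - x₁ - x₂)
    (hD : D = (x₁ + x₂) * Real.exp (-x₁) + a * x₂ + b)
    (h1 : x₁ + x₂ ≠ 1) (h2 : D ≠ 0)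
    (hL111 : L111 = ((x₁ + x₂ - 2) * Real.exp (-x₁) - a * x₂ - b) / D)
    (hL222 : L222 = ((2 - x₁ - x₂) * Real.exp (-x₁) - a * (2 * x₁ + x₂ - 2) + b)
      / ((x₁ + x₂ - 1) * D))
    (hL121 : L121 = (Real.exp (-x₁) + a - x₁ * a + b) / (D * (x₁ + x₂ - 1)))
    (hL122 : L122 = (x₁ + x₂ - 1) * Real.exp (-x₁) / D)
    (hL112 : L112 = 0) (hL221 : L221 = 0) :
    L112 = 0 ∧ L221 = 0 ∧
    L122 = (1 / 2) * (L111 + c * L222 - 2 * c * L121) ∧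
    2 * c * L121 - c * L222 = -1 := by
  have hs : x₁ + x₂ - 1 ≠ 0 := sub_ne_zero.mpr h1
  have base : 2 * c * L121 - c * L222 = -1 := by
    have hcs : c = -(x₁ + x₂ - 1) := by rw [hc]; ring
    rw [hL121, hL222, hcs]
    generalize hS : x₁ + x₂ - 1 = s at hs
    field_simp
    rw [hD]
    ring
  refine ⟨hL112, hL221, ?_, base⟩
  have half : L122 = (1 / 2) * (L111 + 1) := by
    rw [hL122, hL111]
    field_simp
    rw [hD]
    ring
  linear_combination half + (1 / 2) * base
end

section
/- Let a, b ∈ ℝ be constants, D(x₁,x₂) := (x₁+x₂)e^{−x₁} + a x₂ + b, and consider the functions L₁₁¹ = ((x₁+x₂−2)e^{−x₁} − ax₂ − b)/D, L₂₂² = ((2−x₁−x₂)e^{−x₁} − a(2x₁+x₂−2) + b)/((x₁+x₂−1)D), L₁₂¹ = (e^{−x₁} + a − x₁a + b)/(D(x₁+x₂−1)), L₁₂² = (x₁+x₂−1)e^{−x₁}/D. Then at every point with x₁+x₂ ≠ 1 and D ≠ 0, with r = 1/(x₁+x₂−1)², Γ₁ = 1/(x₁+x₂−1), Γ₂ = 1/(1−x₁−x₂),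 the four partial differential equations of linearization hold: (i) r + ∂₁L₁₂¹ − ∂₂L₁₁¹ + L₁₂²L₁₂¹ = 0; (ii) ∂₁L₁₂² − Γ₁L₁₂² + (L₁₂²)² − L₁₁¹L₁₂² = 0; (iii) −∂₂L₁₂¹ + Γ₂L₁₂¹ + L₂₂²L₁₂¹ − (L₁₂¹)² = 0; (iv) r + ∂₁L₂₂² − ∂₂L₁₂² − L₁₂¹L₁₂² = 0. -/
/-- The components of the affine deformation tensor of Solution 2 satisfy the
four PDEs of linearization, with `r = 1/(x₁+x₂−1)²`, `Γ₁ = 1/(x₁+x₂−1)`,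
`Γ₂ = 1/(1−x₁−x₂)`. Here `L^k_{ij}` is written `Lijk`. -/
theorem solution2_satisfies_linearization_PDE (a b : ℝ)
    (D L111 L222 L121 L122 : ℝ × ℝ → ℝ)
    (hD : D = fun p => (p.1 + p.2) * Real.exp (-p.1) + a * p.2 + b)
    (h111 : L111 = fun p =>
      ((p.1 + p.2 - 2) * Real.exp (-p.1) - a * p.2 - b) / D p)
    (h222 : L222 = fun p =>
      ((2 - p.1 - p.2) * Real.exp (-p.1) - a * (2 * p.1 + p.2 - 2) + b)
        / ((p.1 + p.2 - 1) * D p))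
    (h121 : L121 = fun p =>
      (Real.exp (-p.1) + a - p.1 * a + b) / (D p * (p.1 + p.2 - 1)))
    (h122 : L122 = fun p => (p.1 + p.2 - 1) * Real.exp (-p.1) / D p) :
    ∀ p : ℝ × ℝ, p.1 + p.2 ≠ 1 → D p ≠ 0 →
      1 / (p.1 + p.2 - 1) ^ 2 + pd1 L121 p - pd2 L111 p
        + L122 p * L121 p = 0 ∧
      pd1 L122 p - (1 / (p.1 + p.2 - 1)) * L122 p + (L122 p) ^ 2
        - L111 p * L122 p = 0 ∧
      -pd2 L121 p + (1 / (1 - p.1 - p.2)) * L121 p + L222 p * L121 p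
        - (L121 p) ^ 2 = 0 ∧
      1 / (p.1 + p.2 - 1) ^ 2 + pd1 L222 p - pd2 L122 p
        - L121 p * L122 p = 0 := by
  subst hD h111 h222 h121 h122
  rintro ⟨x, y⟩ hs hD
  simp only at hs hD
  have hs₀ : x + y - 1 ≠ 0 := sub_ne_zero.mpr hs
  have hs₁ : 1 / (1 - x - y) = -(1 / (x + y - 1)) := by
    rw [← one_div_neg_eq_neg_one_div]; congr 1; ring
  have hE : HasDerivAt (fun t : ℝ => Real.exp (-t)) (-Real.exp (-x)) x := by
    simpa using (hasDerivAt_neg x).exp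
  have hx : HasDerivAt (fun t : ℝ => t) 1 x := hasDerivAt_id x
  have hy : HasDerivAt (fun t : ℝ => t) 1 y := hasDerivAt_id y
  have hD₁ := ((((hx.add_const y).mul hE).add_const (a * y)).add_const b)
  have hD₂ := ((((hy.const_add x).mul_const (Real.exp (-x))).add (hy.const_mul a)).add_const b)
  have hs_x := (hx.add_const y).sub_const 1
  have hs_y := (hy.const_add x).sub_const 1
  have d121x := ((((hE.add_const a).sub (hx.mul_const a)).add_const b).div
    (hD₁.mul hs_x) (mul_ne_zero hD hs₀)).deriv
  have d121y := ((hasDerivAt_const y (Real.exp (-x) + a - x * a + b)).div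
    (hD₂.mul hs_y) (mul_ne_zero hD hs₀)).deriv
  have d111y := ((((((hy.const_add x).sub_const 2).mul_const (Real.exp (-x))).sub
    (hy.const_mul a)).sub_const b).div hD₂ hD).deriv
  have d122x := ((hs_x.mul hE).div hD₁ hD).deriv
  have d122y := ((hs_y.mul_const (Real.exp (-x))).div hD₂ hD).deriv
  have d222x := ((((((hx.const_sub 2).sub_const y).mul hE).sub
    (((((hx.const_mul 2).add_const y).sub_const 2)).const_mul a)).add_const b).div
    (hs_x.mul hD₁) (mul_ne_zero hs₀ hD)).deriv
  simp only [Pi.add_def, Pi.sub_def, Pi.mul_def, Pi.div_def] at d121x d121y d111y d122x d122y d222x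
  simp only [pd1, pd2, hs₁]
  rw [d121x, d121y, d111y, d122x, d122y, d222x]
  generalize Real.exp (-x) = e at *
  obtain ⟨d, hd⟩ : ∃ d, d = (x + y) * e + a * y + b := ⟨_, rfl⟩
  obtain ⟨s, hs⟩ : ∃ s, s = x + y - 1 := ⟨_, rfl⟩
  simp only [← hd, ← hs] at hD hs₀ ⊢
  obtain rfl : b = d - (x + y) * e - a * y := by linarith
  obtain rfl : y = s + 1 - x := by linarith
  refine ⟨?_, ?_, ?_, ?_⟩ <;> field_simp <;> ring
end

section
/- Let a ∈ ℝ be a constant and consider the connection on U₁ := {(x₁,x₂) ∈ ℝ² : x₁+x₂ ≠ 1, x₂ ≠ a} with Christoffel symbols Γ̂¹₁₁ = (x₁+x₂−2)/(1−x₁−x₂), Γ̂¹₁₂ = Γ̂¹₂₁ = (1−x₁−a)/((x₁+x₂−1)(x₂−a)), Γ̂²₂₂ = 2/(a−x₂), and Γ̂²₁₁ = Γ̂²₁₂ = Γ̂²₂₁ = Γ̂¹₂₂ = 0. Then this connection is flat: for all l, k ∈ {1,2}, the curvature expression ∂₁Γ̂^l_{2k} − ∂₂Γ̂^l_{1k}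 + Σ_{m=1,2}(Γ̂^l_{1m}Γ̂^m_{2k} − Γ̂^l_{2m}Γ̂^m_{1k}) vanishes identically on U₁. -/
/-- The derivative in `x₁` of the mixed Christoffel symbol `Γ̂¹₂₁`. -/
theorem pd1_mixed_symbol {a x y : ℝ} (ht : x + y - 1 ≠ 0) (hu : y - a ≠ 0) :
    pd1 (fun p => (1 - p.1 - a) / ((p.1 + p.2 - 1) * (p.2 - a))) (x, y)
      = -1 / (x + y - 1) ^ 2 := by
  have hn : HasDerivAt (fun s : ℝ => 1 - s - a) (-1) x :=
    ((hasDerivAt_id x).const_sub 1).sub_const a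
  have hd : HasDerivAt (fun s : ℝ => (s + y - 1) * (y - a)) (1 * (y - a)) x :=
    (((hasDerivAt_id x).add_const y).sub_const 1).mul_const (y - a)
  refine (hn.fun_div hd (mul_ne_zero ht hu)).deriv.trans ?_
  field_simp
  ring

/-- The derivative in `x₂` of the mixed Christoffel symbol `Γ̂¹₁₂`. -/
theorem pd2_mixed_symbol {a x y : ℝ} (ht : x + y - 1 ≠ 0) (hu : y - a ≠ 0) :
    pd2 (fun p => (1 - p.1 - a) / ((p.1 + p.2 - 1) * (p.2 - a))) (x, y)
      = 1 / (y - a) ^ 2 - 1 / (x + y - 1) ^ 2 := by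
  have hd : HasDerivAt (fun s : ℝ => (x + s - 1) * (s - a))
      (1 * (y - a) + (x + y - 1) * 1) y :=
    (((hasDerivAt_id y).const_add x).sub_const 1).fun_mul ((hasDerivAt_id y).sub_const a)
  refine ((hasDerivAt_const y (1 - x - a)).fun_div hd (mul_ne_zero ht hu)).deriv.trans ?_
  field_simp
  ring

/-- The derivative in `x₂` of the Christoffel symbol `Γ̂¹₁₁`. -/
theorem pd2_first_symbol {x y : ℝ} (ht : x + y - 1 ≠ 0) :
    pd2 (fun p => (p.1 + p.2 - 2) / (1 - p.1 - p.2)) (x, y) = -1 / (x + y - 1) ^ 2 := by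
  have ht' : 1 - x - y ≠ 0 := fun h => ht (by linarith)
  have hn : HasDerivAt (fun s : ℝ => x + s - 2) 1 y :=
    ((hasDerivAt_id y).const_add x).sub_const 2
  have hd : HasDerivAt (fun s : ℝ => 1 - x - s) (-1) y := (hasDerivAt_id y).const_sub (1 - x)
  refine (hn.fun_div hd ht').deriv.trans ?_
  rw [div_eq_div_iff (pow_ne_zero 2 ht') (pow_ne_zero 2 ht)]
  ring

/-- The deformed connection of Solution 1 is flat: all components
`R^l_{12k} = ∂₁Γ̂^l_{2k} − ∂₂Γ̂^l_{1k} + Σ_m (Γ̂^l_{1m}Γ̂^m_{2k} − Γ̂^l_{2m}Γ̂^m_{1k})`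
of its curvature tensor vanish on `U₁ = {x₁+x₂ ≠ 1, x₂ ≠ a}`.
Here `Γ l i j` denotes the Christoffel symbol `Γ̂^l_{ij}`, with coordinate
index `1` encoded as `(0 : Fin 2)` and `2` as `(1 : Fin 2)`. -/
theorem solution1_connection_is_flat (a : ℝ)
    (Γ : Fin 2 → Fin 2 → Fin 2 → ℝ × ℝ → ℝ)
    (h000 : Γ 0 0 0 = fun p => (p.1 + p.2 - 2) / (1 - p.1 - p.2))
    (h001 : Γ 0 0 1 = fun p => (1 - p.1 - a) / ((p.1 + p.2 - 1) * (p.2 - a)))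
    (h010 : Γ 0 1 0 = fun p => (1 - p.1 - a) / ((p.1 + p.2 - 1) * (p.2 - a)))
    (h111 : Γ 1 1 1 = fun p => 2 / (a - p.2))
    (h100 : Γ 1 0 0 = fun _ => 0) (h101 : Γ 1 0 1 = fun _ => 0)
    (h110 : Γ 1 1 0 = fun _ => 0) (h011 : Γ 0 1 1 = fun _ => 0) :
    ∀ l k : Fin 2, ∀ p : ℝ × ℝ, p.1 + p.2 ≠ 1 → p.2 ≠ a →
      pd1 (Γ l 1 k) p - pd2 (Γ l 0 k) p
        + ∑ m : Fin 2, (Γ l 0 m p * Γ m 1 k p - Γ l 1 m p * Γ m 0 k p)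
        = 0 := by
  intro l k p hs ha
  obtain ⟨x, y⟩ := p
  have ht : x + y - 1 ≠ 0 := sub_ne_zero.mpr hs
  have ht' : 1 - x - y ≠ 0 := fun h => ht (by linarith)
  have hu : y - a ≠ 0 := sub_ne_zero.mpr ha
  have hu' : a - y ≠ 0 := fun h => hu (by linarith)
  fin_cases l <;> fin_cases k
  · have hd1 : pd1 (Γ 0 1 0) (x, y) = -1 / (x + y - 1) ^ 2 := by
      rw [h010]
      exact pd1_mixed_symbol ht hu
    have hd2 : pd2 (Γ 0 0 0) (x, y) = -1 / (x + y - 1) ^ 2 := by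
      rw [h000]
      exact pd2_first_symbol ht
    simp [hd1, hd2, h100, h110, mul_comm (Γ 0 0 0 (x, y))]
  · have hd1 : pd1 (Γ 0 1 1) (x, y) = 0 := by simp [h011, pd1]
    have hd2 : pd2 (Γ 0 0 1) (x, y) = 1 / (y - a) ^ 2 - 1 / (x + y - 1) ^ 2 := by
      rw [h001]
      exact pd2_mixed_symbol ht hu
    simp only [Fin.zero_eta, Fin.mk_one, Fin.isValue, Fin.sum_univ_two, hd1, hd2]
    simp only [h000, h001, h010, h011, h101, h111]
    field_simp
    ring
  · simp [pd1, pd2, h100, h110, h101]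
  · simp [pd1, pd2, h111, h101, h110, h100, h011]
end

section
/- Let a, b ∈ ℝ be constants, D(x₁,x₂) := (x₁+x₂)e^{−x₁} + a x₂ + b, and consider the connection on U₂ := {(x₁,x₂) ∈ ℝ² : x₁+x₂ ≠ 1, D(x₁,x₂) ≠ 0} with Christoffel symbols Γ̂¹₁₁ = 1/(x₁+x₂−1) + ((x₁+x₂−2)e^{−x₁} − ax₂ − b)/D, Γ̂¹₁₂ = Γ̂¹₂₁ = (e^{−x₁} + a − x₁a + b)/(D(x₁+x₂−1)), Γ̂²₁₂ = Γ̂²₂₁ = (x₁+x₂−1)e^{−x₁}/D, Γ̂²₂₂ = −2(e^{−x₁} + a)/D, and Γ̂²₁₁ = Γ̂¹₂₂ = 0. Then this connection is flat: for all l, k ∈ {1,2}, the curvature expression ∂₁Γ̂^l_{2k} − ∂₂Γ̂^l_{1k} + Σ_{m=1,2}(Γ̂^l_{1m}Γ̂^m_{2k} − Γ̂^l_{2m}Γ̂^m_{1k}) vanishes identically on U₂. -/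
theorem pd1_eq_of_hasDerivAt {g : ℝ × ℝ → ℝ} {p : ℝ × ℝ} {g' : ℝ}
    (h : HasDerivAt (fun x => g (x, p.2)) g' p.1) : pd1 g p = g' :=
  h.deriv

theorem pd2_eq_of_hasDerivAt {g : ℝ × ℝ → ℝ} {p : ℝ × ℝ} {g' : ℝ}
    (h : HasDerivAt (fun y => g (p.1, y)) g' p.2) : pd2 g p = g' :=
  h.deriv

/-- The deformed connection of Solution 2 is flat: all components
`R^l_{12k} = ∂₁Γ̂^l_{2k} − ∂₂Γ̂^l_{1k} + Σ_m (Γ̂^l_{1m}Γ̂^m_{2k} − Γ̂^l_{2m}Γ̂^m_{1k})`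
of its curvature tensor vanish on `U₂ = {x₁+x₂ ≠ 1, D ≠ 0}` where
`D = (x₁+x₂)e^{−x₁} + a x₂ + b`. Here `Γ l i j` denotes the Christoffel
symbol `Γ̂^l_{ij}`, with coordinate index `1` encoded as `(0 : Fin 2)` and
`2` as `(1 : Fin 2)`. -/
theorem solution2_connection_is_flat (a b : ℝ) (D : ℝ × ℝ → ℝ)
    (hD : D = fun p => (p.1 + p.2) * Real.exp (-p.1) + a * p.2 + b)
    (Γ : Fin 2 → Fin 2 → Fin 2 → ℝ × ℝ → ℝ)
    (h000 : Γ 0 0 0 = fun p => 1 / (p.1 + p.2 - 1)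
      + ((p.1 + p.2 - 2) * Real.exp (-p.1) - a * p.2 - b) / D p)
    (h001 : Γ 0 0 1 = fun p =>
      (Real.exp (-p.1) + a - p.1 * a + b) / (D p * (p.1 + p.2 - 1)))
    (h010 : Γ 0 1 0 = fun p =>
      (Real.exp (-p.1) + a - p.1 * a + b) / (D p * (p.1 + p.2 - 1)))
    (h101 : Γ 1 0 1 = fun p => (p.1 + p.2 - 1) * Real.exp (-p.1) / D p)
    (h110 : Γ 1 1 0 = fun p => (p.1 + p.2 - 1) * Real.exp (-p.1) / D p)
    (h111 : Γ 1 1 1 = fun p => -2 * (Real.exp (-p.1) + a) / D p)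
    (h100 : Γ 1 0 0 = fun _ => 0) (h011 : Γ 0 1 1 = fun _ => 0) :
    ∀ l k : Fin 2, ∀ p : ℝ × ℝ, p.1 + p.2 ≠ 1 → D p ≠ 0 →
      pd1 (Γ l 1 k) p - pd2 (Γ l 0 k) p
        + ∑ m : Fin 2, (Γ l 0 m p * Γ m 1 k p - Γ l 1 m p * Γ m 0 k p)
        = 0 := by
  rintro l k ⟨x, y⟩ hs hp
  replace hs : x + y - 1 ≠ 0 := sub_ne_zero.mpr hs
  have hDv : D (x, y) = (x + y) * Real.exp (-x) + a * y + b := by rw [hD]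
  have hE : HasDerivAt (fun t : ℝ => Real.exp (-t)) (-Real.exp (-x)) x := by
    simpa using (hasDerivAt_id x).neg.exp
  have hS₁ : HasDerivAt (fun t : ℝ => t + y - 1) 1 x :=
    ((hasDerivAt_id x).add_const y).sub_const 1
  have hS₂ : HasDerivAt (fun t : ℝ => x + t - 1) 1 y :=
    ((hasDerivAt_id y).const_add x).sub_const 1
  have hD₁ : HasDerivAt (fun t => D (t, y)) (-(x + y - 1) * Real.exp (-x)) x := by
    rw [hD]
    exact (((((hasDerivAt_id x).add_const y).mul hE).add_const (a * y)).add_const b).congr_deriv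
      (by simp only [id]; ring)
  have hD₂ : HasDerivAt (fun t => D (x, t)) (Real.exp (-x) + a) y := by
    rw [hD]
    exact (((((hasDerivAt_id y).const_add x).mul_const (Real.exp (-x))).add
      ((hasDerivAt_id y).const_mul a)).add_const b).congr_deriv (by ring)
  have hM₁ : HasDerivAt (fun t => Real.exp (-t) + a - t * a + b) (-Real.exp (-x) - a) x :=
    (((hE.add_const a).sub ((hasDerivAt_id x).mul_const a)).add_const b).congr_deriv (by ring)
  have hN₂ : HasDerivAt (fun t => (x + t - 2) * Real.exp (-x) - a * t - b)
      (Real.exp (-x) - a) y :=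
    ((((((hasDerivAt_id y).const_add x).sub_const 2).mul_const (Real.exp (-x))).sub
      ((hasDerivAt_id y).const_mul a)).sub_const b).congr_deriv (by ring)
  have d010 := pd1_eq_of_hasDerivAt (g := Γ 0 1 0) (p := (x, y))
    (by rw [h010]; exact hM₁.div (hD₁.mul hS₁) (mul_ne_zero hp hs))
  have d000 := pd2_eq_of_hasDerivAt (g := Γ 0 0 0) (p := (x, y))
    (by rw [h000]; exact ((hasDerivAt_const y 1).div hS₂ hs).add (hN₂.div hD₂ hp))
  have d011 := pd1_eq_of_hasDerivAt (g := Γ 0 1 1) (p := (x, y))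
    (by rw [h011]; exact hasDerivAt_const x 0)
  have d001 := pd2_eq_of_hasDerivAt (g := Γ 0 0 1) (p := (x, y))
    (by rw [h001]; exact (hasDerivAt_const y (Real.exp (-x) + a - x * a + b)).div (hD₂.mul hS₂) (mul_ne_zero hp hs))
  have d110 := pd1_eq_of_hasDerivAt (g := Γ 1 1 0) (p := (x, y))
    (by rw [h110]; exact (hS₁.mul hE).div hD₁ hp)
  have d100 := pd2_eq_of_hasDerivAt (g := Γ 1 0 0) (p := (x, y))
    (by rw [h100]; exact hasDerivAt_const y 0)
  have d111 := pd1_eq_of_hasDerivAt (g := Γ 1 1 1) (p := (x, y))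
    (by rw [h111]; exact ((hE.add_const a).const_mul (-2)).div hD₁ hp)
  have d101 := pd2_eq_of_hasDerivAt (g := Γ 1 0 1) (p := (x, y))
    (by rw [h101]; exact (hS₂.mul_const (Real.exp (-x))).div hD₂ hp)
  rw [Fin.sum_univ_two]
  fin_cases l <;> fin_cases k <;>
    simp only [Fin.zero_eta, Fin.mk_one, Fin.isValue, d000, d001, d010, d011, d100, d101, d110,
      d111] <;>
    simp only [h000, h001, h010, h011, h100, h101, h110, h111, Pi.mul_apply] <;>
    field_simp <;> rw [hDv] <;> ring
end

section
/- Let a, b ∈ ℝ be constants, c(x₁,x₂) = 1 − x₁ − x₂, D(x₁,x₂) := (x₁+x₂)e^{−x₁} + a x₂ + b, and consider the connection on U₂ := {(x₁,x₂) ∈ ℝ² : x₁+x₂ ≠ 1, D(x₁,x₂) ≠ 0} with Christoffel symbols Γ̂¹₁₁ = 1/(x₁+x₂−1) + ((x₁+x₂−2)e^{−x₁} − ax₂ − b)/D, Γ̂¹₁₂ = Γ̂¹₂₁ = (e^{−x₁} + a − x₁a + b)/(D(x₁+x₂−1)), Γ̂²₁₂ = Γ̂²₂₁ = (x₁+x₂−1)e^{−x₁}/D,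 Γ̂²₂₂ = −2(e^{−x₁} + a)/D, and Γ̂²₁₁ = Γ̂¹₂₂ = 0. Then the transversal vector field X := ∂₁ − c∂₂ satisfies ∇^L_X X = μ·X on U₂, where μ(x₁,x₂) = ((x₁+x₂)²e^{−x₁} + (4a+b)(x₁+x₂) − a(2x₁² + x₂² + 3x₂x₁ + 2))/((x₁+x₂−1)D); equivalently, the two component identities hold on U₂: Γ̂¹₁₁ − 2cΓ̂¹₁₂ + c²Γ̂¹₂₂ = μ and Γ̂²₁₁ − 2cΓ̂²₁₂ + c²Γ̂²₂₂ + 1 − c = −cμ. In particular the leaves of the transversal foliation (x₁+x₂)e^{−x₁} = const are auto-parallel curves of this connection. -/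
/-- For the deformed connection of Solution 2, the transversal vector field
`X = ∂₁ − c∂₂` (with `c = 1 − x₁ − x₂`) satisfies `∇^L_X X = μ·X` on
`U₂ = {x₁+x₂ ≠ 1, D ≠ 0}` where `D = (x₁+x₂)e^{−x₁} + a x₂ + b` and
`μ = ((x₁+x₂)²e^{−x₁} + (4a+b)(x₁+x₂) − a(2x₁² + x₂² + 3x₂x₁ + 2))/((x₁+x₂−1)D)`;
equivalently `Γ̂¹₁₁ − 2cΓ̂¹₁₂ + c²Γ̂¹₂₂ = μ` and
`Γ̂²₁₁ − 2cΓ̂²₁₂ + c²Γ̂²₂₂ + 1 − c = −cμ`. Hence the leaves of the transversal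
foliation are auto-parallel curves of this connection. Here `Γ l i j` denotes
the Christoffel symbol `Γ̂^l_{ij}`, with coordinate index `1` encoded as
`(0 : Fin 2)` and `2` as `(1 : Fin 2)`. -/
theorem solution2_transversal_autoparallel (a b : ℝ) (D : ℝ × ℝ → ℝ)
    (hD : D = fun p => (p.1 + p.2) * Real.exp (-p.1) + a * p.2 + b)
    (Γ : Fin 2 → Fin 2 → Fin 2 → ℝ × ℝ → ℝ)
    (h000 : Γ 0 0 0 = fun p => 1 / (p.1 + p.2 - 1)
      + ((p.1 + p.2 - 2) * Real.exp (-p.1) - a * p.2 - b) / D p)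
    (h001 : Γ 0 0 1 = fun p =>
      (Real.exp (-p.1) + a - p.1 * a + b) / (D p * (p.1 + p.2 - 1)))
    (h010 : Γ 0 1 0 = fun p =>
      (Real.exp (-p.1) + a - p.1 * a + b) / (D p * (p.1 + p.2 - 1)))
    (h101 : Γ 1 0 1 = fun p => (p.1 + p.2 - 1) * Real.exp (-p.1) / D p)
    (h110 : Γ 1 1 0 = fun p => (p.1 + p.2 - 1) * Real.exp (-p.1) / D p)
    (h111 : Γ 1 1 1 = fun p => -2 * (Real.exp (-p.1) + a) / D p)
    (h100 : Γ 1 0 0 = fun _ => 0) (h011 : Γ 0 1 1 = fun _ => 0)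
    (c μ : ℝ × ℝ → ℝ)
    (hc : c = fun p => 1 - p.1 - p.2)
    (hμ : μ = fun p =>
      ((p.1 + p.2) ^ 2 * Real.exp (-p.1) + (4 * a + b) * (p.1 + p.2)
          - a * (2 * p.1 ^ 2 + p.2 ^ 2 + 3 * p.2 * p.1 + 2))
        / ((p.1 + p.2 - 1) * D p)) :
    ∀ p : ℝ × ℝ, p.1 + p.2 ≠ 1 → D p ≠ 0 →
      Γ 0 0 0 p - 2 * c p * Γ 0 0 1 p + (c p) ^ 2 * Γ 0 1 1 p = μ p ∧
      Γ 1 0 0 p - 2 * c p * Γ 1 0 1 p + (c p) ^ 2 * Γ 1 1 1 p + 1 - c p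
        = -(c p) * μ p := by
  intro p hp hDp
  have hw : p.1 + p.2 - 1 ≠ 0 := sub_ne_zero.mpr hp
  have hDe : D p = (p.1 + p.2) * Real.exp (-p.1) + a * p.2 + b := by rw [hD]
  simp only [h000, h001, h011, h100, h101, h111, hc, hμ]
  generalize D p = d at hDp hDe
  generalize Real.exp (-p.1) = e at hDe
  constructor <;> field_simp <;> rw [hDe] <;> ring
end

section
/- There exist a nonempty open set U ⊆ ℝ² and smooth functions Γ̂^k_{ij} : U → ℝ (i,j,k ∈ {1,2}) with Γ̂^k_{ij} = Γ̂^k_{ji}, such that: (i) the connection is flat, i.e. for all l, k ∈ {1,2} the curvature expression ∂₁Γ̂^l_{2k} − ∂₂Γ̂^l_{1k} + Σ_{m=1,2}(Γ̂^l_{1m}Γ̂^m_{2k} − Γ̂^l_{2m}Γ̂^m_{1k}) vanishes identically on U; (ii) Γ̂²₁₁ = 0 and Γ̂¹₂₂ = 0 on U (so the horizontal leaves x₂ = const and vertical leaves x₁ = const are auto-parallel); (iii) with c(x₁,x₂) = 1 − x₁ − x₂, the identity 1 − c + Γ̂²₁₁ − 2cΓ̂²₁₂ + c²Γ̂²₂₂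 = −c(Γ̂¹₁₁ − 2cΓ̂¹₁₂ + c²Γ̂¹₂₂) holds on U (so the transversal leaves (x₁+x₂)e^{−x₁} = const are auto-parallel). Consequently the 3-web on the plane given by the three foliations x₁ = const, x₂ = const, (x₁+x₂)e^{−x₁} = const is linearizable. -/
/-- The Christoffel symbol `Γ̂¹₁₂ = 1/(x₁ + x₂ − 1)` of the linearizing connection. -/
noncomputable def webGamma (p : ℝ × ℝ) : ℝ := (p.1 + p.2 - 1)⁻¹

/-- The linearizing flat connection: `Γ̂¹₁₁ = 1/(x₁ + x₂ − 1) − 1`,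
`Γ̂¹₁₂ = Γ̂¹₂₁ = 1/(x₁ + x₂ − 1)`, all other symbols zero. -/
noncomputable def webConnection : Fin 2 → Fin 2 → Fin 2 → ℝ × ℝ → ℝ :=
  ![![![fun p => webGamma p - 1, webGamma], ![webGamma, fun _ => 0]],
    ![![fun _ => 0, fun _ => 0], ![fun _ => 0, fun _ => 0]]]

theorem pd1_const (a : ℝ) (p : ℝ × ℝ) : pd1 (fun _ => a) p = 0 := by
  simp [pd1]

theorem pd2_const (a : ℝ) (p : ℝ × ℝ) : pd2 (fun _ => a) p = 0 := by
  simp [pd2]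

theorem pd2_sub_const (g : ℝ × ℝ → ℝ) (a : ℝ) (p : ℝ × ℝ) :
    pd2 (fun q => g q - a) p = pd2 g p := by
  simp [pd2]

theorem pd1_webGamma {p : ℝ × ℝ} (hp : p.1 + p.2 - 1 ≠ 0) :
    pd1 webGamma p = -webGamma p ^ 2 := by
  have h : HasDerivAt (fun x : ℝ => x + p.2 - 1) 1 p.1 :=
    ((hasDerivAt_id p.1).add_const p.2).sub_const 1
  refine (h.inv hp).deriv.trans ?_
  simp [webGamma, neg_div]

theorem pd2_webGamma {p : ℝ × ℝ} (hp : p.1 + p.2 - 1 ≠ 0) :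
    pd2 webGamma p = -webGamma p ^ 2 := by
  have h : HasDerivAt (fun y : ℝ => p.1 + y - 1) 1 p.2 :=
    ((hasDerivAt_id p.2).const_add p.1).sub_const 1
  refine (h.inv hp).deriv.trans ?_
  simp [webGamma, neg_div]

theorem contDiffOn_webGamma :
    ContDiffOn ℝ (⊤ : ℕ∞) webGamma {p : ℝ × ℝ | p.1 + p.2 - 1 ≠ 0} :=
  ContDiffOn.inv (by fun_prop) fun _ hp => hp

/-- There exist a nonempty open set `U ⊆ ℝ²` and smooth symmetric Christoffel
symbols `Γ̂^k_{ij}` on `U` such that (i) the connection is flat, (ii)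
`Γ̂²₁₁ = 0` and `Γ̂¹₂₂ = 0` (so the horizontal and vertical leaves are
auto-parallel), and (iii) with `c = 1 − x₁ − x₂`,
`1 − c + Γ̂²₁₁ − 2cΓ̂²₁₂ + c²Γ̂²₂₂ = −c(Γ̂¹₁₁ − 2cΓ̂¹₁₂ + c²Γ̂¹₂₂)` (so the
transversal leaves `(x₁+x₂)e^{−x₁} = const` are auto-parallel). Hence the
3-web given by `x₁ = const`, `x₂ = const`, `(x₁+x₂)e^{−x₁} = const` is
linearizable. Here `Γ l i j` denotes the Christoffel symbol `Γ̂^l_{ij}`, with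
coordinate index `1` encoded as `(0 : Fin 2)` and `2` as `(1 : Fin 2)`. -/
theorem example_web_is_linearizable :
    ∃ (U : Set (ℝ × ℝ)) (Γ : Fin 2 → Fin 2 → Fin 2 → ℝ × ℝ → ℝ),
      U.Nonempty ∧ IsOpen U ∧
      (∀ l i j : Fin 2, ContDiffOn ℝ (⊤ : ℕ∞) (Γ l i j) U) ∧
      (∀ l i j : Fin 2, ∀ p ∈ U, Γ l i j p = Γ l j i p) ∧
      (∀ l k : Fin 2, ∀ p ∈ U,
        pd1 (Γ l 1 k) p - pd2 (Γ l 0 k) p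
          + ∑ m : Fin 2, (Γ l 0 m p * Γ m 1 k p - Γ l 1 m p * Γ m 0 k p)
          = 0) ∧
      (∀ p ∈ U, Γ 1 0 0 p = 0 ∧ Γ 0 1 1 p = 0) ∧
      (∀ p ∈ U,
        1 - (1 - p.1 - p.2) + Γ 1 0 0 p - 2 * (1 - p.1 - p.2) * Γ 1 0 1 p
            + (1 - p.1 - p.2) ^ 2 * Γ 1 1 1 p
          = -(1 - p.1 - p.2) *
            (Γ 0 0 0 p - 2 * (1 - p.1 - p.2) * Γ 0 0 1 p
              + (1 - p.1 - p.2) ^ 2 * Γ 0 1 1 p)) := by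
  refine ⟨{p | p.1 + p.2 - 1 ≠ 0}, webConnection, ⟨(0, 0), by simp⟩,
    isOpen_ne_fun (by fun_prop) continuous_const, ?_, ?_, ?_, ?_, ?_⟩
  · intro l i j
    fin_cases l <;> fin_cases i <;> fin_cases j <;>
      first
      | exact contDiffOn_const
      | exact contDiffOn_webGamma
      | exact contDiffOn_webGamma.sub contDiffOn_const
  · intro l i j p _
    fin_cases l <;> fin_cases i <;> fin_cases j <;> rfl
  · intro l k p hp
    fin_cases l <;> fin_cases k <;>
      simp [webConnection, Fin.sum_univ_two, pd1_const, pd2_const, pd2_sub_const,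
        pd1_webGamma hp, pd2_webGamma hp] <;> ring
  · intro p _
    exact ⟨rfl, rfl⟩
  · intro p hp
    have h : webGamma p * (p.1 + p.2 - 1) = 1 := inv_mul_cancel₀ hp
    simp [webConnection]
    linear_combination (1 - 2 * (p.1 + p.2)) * h
end
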